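/- arXiv:1705.02443 — 2 statements merged into one kernel-verified Lean document; each statement's English description precedes it below -/
import Mathlib

section
/- (Lemma 3) For each fixed n ≥ 1, the minimal bounding area T₀, viewed as a function ℝ_{>0}^{2n} → ℝ sending (w₁, l₁, …, wₙ, lₙ) to T₀ of the corresponding family of n rectangles, is continuous; i.e., T₀(A + ΔA) → T₀(A) as ΔA → 0. -/
open Set Finset Function

/-- A positioning of a family of rectangles (widths `w`, heights `l`) assigns
lower-left corners `(a i, b i)` so that the open interiors are pairwise disjoint. -/
def IsPositioning {ι : Type*} (w l a b : ι → ℝ) : Prop :=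
  ∀ i j, i ≠ j →
    Disjoint (Set.Ioo (a i) (a i + w i) ×ˢ Set.Ioo (b i) (b i + l i))
             (Set.Ioo (a j) (a j + w j) ×ˢ Set.Ioo (b j) (b j + l j))

/-- Horizontal extent `p(M) = max_{i,j} ((a i + w i) - a j)`. -/
noncomputable def pval {n : ℕ} (w a : Fin n → ℝ) : ℝ :=
  ⨆ i, ⨆ j, (a i + w i - a j)

/-- Vertical extent `q(M) = max_{i,j} ((b i + l i) - b j)`. -/
noncomputable def qval {n : ℕ} (l b : Fin n → ℝ) : ℝ :=
  ⨆ i, ⨆ j, (b i + l i - b j)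

/-- Bounding area `T(M) = p(M) * q(M)`. -/
noncomputable def Tval {n : ℕ} (w l a b : Fin n → ℝ) : ℝ :=
  pval w a * qval l b

/-- Total area `S(A) = ∑ i, w i * l i`. -/
noncomputable def Sval {n : ℕ} (w l : Fin n → ℝ) : ℝ :=
  ∑ i, w i * l i

/-- Packing efficiency `η(M) = S(A) / T(M)`. -/
noncomputable def eta {n : ℕ} (w l a b : Fin n → ℝ) : ℝ :=
  Sval w l / Tval w l a b

/-- Best packing efficiency `η₀(A) = sup over positionings M of η(M)`. -/
noncomputable def eta0 {n : ℕ} (w l : Fin n → ℝ) : ℝ :=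
  sSup {e | ∃ a b : Fin n → ℝ, IsPositioning w l a b ∧ e = eta w l a b}

/-- Minimal bounding area `T₀(A) = inf over positionings M of T(M)`. -/
noncomputable def T0 {n : ℕ} (w l : Fin n → ℝ) : ℝ :=
  sInf {t | ∃ a b : Fin n → ℝ, IsPositioning w l a b ∧ t = Tval w l a b}

section Extent

variable {n : ℕ} (w a : Fin n → ℝ)

lemma sub_le_pval (i j : Fin n) : a i + w i - a j ≤ pval w a :=
  (le_ciSup (f := fun j => a i + w i - a j) (Set.finite_range _).bddAbove j).trans
    (le_ciSup (f := fun i => ⨆ j, (a i + w i - a j)) (Set.finite_range _).bddAbove i)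

lemma pval_pos {w : Fin (n + 1) → ℝ} (hw : ∀ i, 0 < w i) (a : Fin (n + 1) → ℝ) :
    0 < pval w a :=
  (hw 0).trans_le (by simpa using sub_le_pval w a 0 0)

lemma pval_le_mul {w w' : Fin (n + 1) → ℝ} {c : ℝ} (hc : 0 ≤ c) (h : ∀ i, w' i ≤ c * w i)
    (a : Fin (n + 1) → ℝ) : pval w' (fun i => c * a i) ≤ c * pval w a := by
  refine ciSup_le fun i => ciSup_le fun j => ?_
  have := mul_le_mul_of_nonneg_left (sub_le_pval w a i j) hc
  linarith [h i]

end Extent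

lemma Tval_pos {n : ℕ} {w l : Fin (n + 1) → ℝ} (hw : ∀ i, 0 < w i) (hl : ∀ i, 0 < l i)
    (a b : Fin (n + 1) → ℝ) : 0 < Tval w l a b :=
  mul_pos (pval_pos hw a) (pval_pos hl b)

lemma Tval_le_mul {n : ℕ} {w l w' l' : Fin (n + 1) → ℝ} {c : ℝ} (hc : 0 ≤ c)
    (hw : ∀ i, 0 < w i) (hl' : ∀ i, 0 < l' i)
    (hww : ∀ i, w' i ≤ c * w i) (hll : ∀ i, l' i ≤ c * l i) (a b : Fin (n + 1) → ℝ) :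
    Tval w' l' (fun i => c * a i) (fun i => c * b i) ≤ c ^ 2 * Tval w l a b :=
  calc pval w' (fun i => c * a i) * pval l' (fun i => c * b i)
      ≤ (c * pval w a) * (c * pval l b) :=
        mul_le_mul (pval_le_mul hc hww a) (pval_le_mul hc hll b) (pval_pos hl' _).le
          (mul_nonneg hc (pval_pos hw a).le)
    _ = c ^ 2 * (pval w a * pval l b) := by ring

/-- Scaling a positioning by `c` leaves room for rectangles up to `c` times as large. -/
lemma IsPositioning.scale {ι : Type*} {w l w' l' a b : ι → ℝ} {c : ℝ} (hc : 0 < c)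
    (hww : ∀ i, w' i ≤ c * w i) (hll : ∀ i, l' i ≤ c * l i) (h : IsPositioning w l a b) :
    IsPositioning w' l' (fun i => c * a i) (fun i => c * b i) := by
  have key : ∀ {u u' s : ι → ℝ} (_ : ∀ i, u' i ≤ c * u i) (i : ι) {x : ℝ},
      x ∈ Set.Ioo (c * s i) (c * s i + u' i) → x / c ∈ Set.Ioo (s i) (s i + u i) := by
    intro u u' s hu i x hx
    rw [Set.mem_Ioo, lt_div_iff₀ hc, div_lt_iff₀ hc]
    constructor <;> nlinarith [hu i, hx.1, hx.2]
  intro i j hij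
  rw [Set.disjoint_left]
  rintro ⟨x, y⟩ ⟨hx, hy⟩ ⟨hx', hy'⟩
  exact Set.disjoint_left.1 (h i j hij) (Set.mk_mem_prod (key hww i hx) (key hll i hy))
    (Set.mk_mem_prod (key hww j hx') (key hll j hy'))

lemma exists_isPositioning {n : ℕ} {w : Fin n → ℝ} (hw : ∀ i, 0 < w i) (l : Fin n → ℝ) :
    ∃ a b : Fin n → ℝ, IsPositioning w l a b := by
  set W := ∑ i, w i
  have hW : ∀ i, w i ≤ W := fun i =>
    Finset.single_le_sum (fun j _ => (hw j).le) (Finset.mem_univ i)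
  have key : ∀ i j : Fin n, i < j → (i : ℝ) * W + w i ≤ j * W := by
    intro i j hij
    have h1 : (i : ℝ) + 1 ≤ j := by exact_mod_cast hij
    nlinarith [hW i, hw i]
  refine ⟨fun i => i * W, 0, fun i j hij => Set.disjoint_left.2 ?_⟩
  rintro ⟨x, y⟩ ⟨hx, -⟩ ⟨hx', -⟩
  simp only [Set.mem_Ioo] at hx hx'
  rcases lt_or_gt_of_ne hij with h | h
  · linarith [key i j h]
  · linarith [key j i h]

lemma T0_le_mul {n : ℕ} {w l w' l' : Fin (n + 1) → ℝ} {c : ℝ} (hc : 0 < c)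
    (hw : ∀ i, 0 < w i) (hw' : ∀ i, 0 < w' i) (hl' : ∀ i, 0 < l' i)
    (hww : ∀ i, w' i ≤ c * w i) (hll : ∀ i, l' i ≤ c * l i) :
    T0 w' l' ≤ c ^ 2 * T0 w l := by
  rw [← div_le_iff₀' (by positivity)]
  obtain ⟨a, b, hab⟩ := exists_isPositioning hw l
  refine le_csInf ⟨_, a, b, hab, rfl⟩ ?_
  rintro _ ⟨a, b, hab, rfl⟩
  rw [div_le_iff₀' (by positivity)]
  refine le_trans (csInf_le ⟨0, ?_⟩ ?_) (Tval_le_mul hc.le hw hl' hww hll a b)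
  swap
  · exact ⟨_, _, hab.scale hc hww hll, rfl⟩
  rintro _ ⟨a, b, -, rfl⟩
  exact (Tval_pos hw' hl' a b).le

/-- Near a positive vector, the ratios of coordinates are at most `c`, for any `c > 1`. -/
lemma eventually_le_mul_and_le_mul {ι : Type*} [Finite ι] {u : ι → ℝ} (hu : ∀ i, 0 < u i)
    {c : ℝ} (hc : 1 < c) :
    ∀ᶠ v in nhds u, ∀ i, v i ≤ c * u i ∧ u i ≤ c * v i := by
  refine Filter.eventually_all.2 fun i => ?_
  have hlt : u i < c * u i := lt_mul_of_one_lt_left (hu i) hc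
  have hcont : ContinuousAt (fun v : ι → ℝ => v i) u := (continuous_apply i).continuousAt
  filter_upwards [hcont.eventually_lt_const hlt,
    (hcont.const_mul c).eventually_const_lt hlt] with v h1 h2
  exact ⟨h1.le, h2.le⟩

lemma exists_one_lt_sq_mul_lt {x y : ℝ} (h : x < y) : ∃ c : ℝ, 1 < c ∧ c ^ 2 * x < y := by
  have hcont : ContinuousAt (fun c : ℝ => c ^ 2 * x) 1 := by fun_prop
  have hev : ∀ᶠ c in nhdsWithin (1 : ℝ) (Set.Ioi 1), c ^ 2 * x < y :=
    nhdsWithin_le_nhds (hcont.eventually_lt_const (by simpa using h))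
  exact (eventually_mem_nhdsWithin.and hev).exists

/-- Lemma 3: for each fixed `n ≥ 1`, the minimal bounding area `T₀` is a
continuous function of the side lengths on `ℝ_{>0}^{2n}`. -/
theorem T0_continuousOn {n : ℕ} :
    ContinuousOn
      (fun A : (Fin (n + 1) → ℝ) × (Fin (n + 1) → ℝ) => T0 A.1 A.2)
      {A : (Fin (n + 1) → ℝ) × (Fin (n + 1) → ℝ) |
        (∀ i, 0 < A.1 i) ∧ (∀ i, 0 < A.2 i)} := by
  rintro ⟨w, l⟩ ⟨hw, hl⟩
  have key : ∀ c : ℝ, 1 < c → ∀ᶠ A in nhdsWithin (w, l)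
      {A : (Fin (n + 1) → ℝ) × (Fin (n + 1) → ℝ) | (∀ i, 0 < A.1 i) ∧ (∀ i, 0 < A.2 i)},
      T0 A.1 A.2 ≤ c ^ 2 * T0 w l ∧ T0 w l ≤ c ^ 2 * T0 A.1 A.2 := by
    intro c hc
    have hc0 : 0 < c := one_pos.trans hc
    filter_upwards [self_mem_nhdsWithin,
      nhdsWithin_le_nhds (continuousAt_fst.eventually (eventually_le_mul_and_le_mul hw hc)),
      nhdsWithin_le_nhds (continuousAt_snd.eventually (eventually_le_mul_and_le_mul hl hc))]
      with A hA h1 h2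
    exact ⟨T0_le_mul hc0 hw hA.1 hA.2 (fun i => (h1 i).1) fun i => (h2 i).1,
      T0_le_mul hc0 hA.1 hw hl (fun i => (h1 i).2) fun i => (h2 i).2⟩
  refine tendsto_order.2 ⟨fun y hy => ?_, fun y hy => ?_⟩
  · obtain ⟨c, hc, hcy⟩ := exists_one_lt_sq_mul_lt hy
    filter_upwards [key c hc] with A hA
    exact lt_of_mul_lt_mul_left (hcy.trans_le hA.2) (sq_nonneg c)
  · obtain ⟨c, hc, hcy⟩ := exists_one_lt_sq_mul_lt hy
    filter_upwards [key c hc] with A hA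
    exact hA.1.trans_lt hcy
end

section
/- (Convergence of minimal bounding areas, Theorem 2) Let A be a countably infinite family of rectangles with widths wᵢ > 0 and heights lᵢ > 0 satisfying (C1) Σᵢ lᵢ² < ∞ and (C2) wᵢ ≤ lᵢ and lᵢ₊₁ ≤ lᵢ for all i, and let Aⁿ denote the finite family of the first n rectangles. Then T₀(Aⁿ) → T₀(A) as n → ∞. -/
open Set Finset Function

/-- Minimal bounding area of a countably infinite family of rectangles:
the infimum of `P * Q` over all positionings that fit within horizontal extent `P`
and vertical extent `Q`. -/
noncomputable def T0inf (w l : ℕ → ℝ) : ℝ :=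
  sInf {t | ∃ a b : ℕ → ℝ, ∃ P Q : ℝ, IsPositioning w l a b ∧
    (∀ i j, a i + w i - a j ≤ P) ∧ (∀ i j, b i + l i - b j ≤ Q) ∧ t = P * Q}

/-- The greedy packing of squares of sides `s` into columns of height `H`. After square `n` has been
placed, the state is (left edge of the current column, its width, its used height). -/
noncomputable def shelfState (H : ℝ) (s : ℕ → ℝ) : ℕ → ℝ × ℝ × ℝ
  | 0 => (0, s 0, s 0)
  | n + 1 =>
    let t := shelfState H s n
    if t.2.2 + s (n + 1) ≤ H then (t.1, t.2.1, t.2.2 + s (n + 1))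
    else (t.1 + t.2.1, s (n + 1), s (n + 1))

section shelf

variable {H : ℝ} {s : ℕ → ℝ}

lemma shelfState_succ_cases (H : ℝ) (s : ℕ → ℝ) (n : ℕ) :
    ((shelfState H s n).2.2 + s (n + 1) ≤ H ∧
      (shelfState H s (n + 1)).1 = (shelfState H s n).1 ∧
      (shelfState H s (n + 1)).2.1 = (shelfState H s n).2.1 ∧
      (shelfState H s (n + 1)).2.2 = (shelfState H s n).2.2 + s (n + 1)) ∨
    (H < (shelfState H s n).2.2 + s (n + 1) ∧
      (shelfState H s (n + 1)).1 = (shelfState H s n).1 + (shelfState H s n).2.1 ∧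
      (shelfState H s (n + 1)).2.1 = s (n + 1) ∧
      (shelfState H s (n + 1)).2.2 = s (n + 1)) := by
  by_cases h : (shelfState H s n).2.2 + s (n + 1) ≤ H
  · left
    simp [shelfState, h]
  · right
    simp [shelfState, h, not_le.mp h]

lemma shelfState_bounds (hs : ∀ i, 0 < s i) (hanti : Antitone s) (hH : s 0 ≤ H / 2) (n : ℕ) :
    0 ≤ (shelfState H s n).1 ∧ s n ≤ (shelfState H s n).2.1 ∧
      s n ≤ (shelfState H s n).2.2 ∧ (shelfState H s n).2.2 ≤ H := by
  have hsn : ∀ n, s n ≤ H / 2 := fun n => (hanti (Nat.zero_le n)).trans hH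
  induction n with
  | zero =>
    simp only [shelfState]
    refine ⟨le_rfl, le_rfl, le_rfl, ?_⟩
    linarith [hs 0]
  | succ n ih =>
    have h1 := hs n
    have h2 := hs (n + 1)
    have h3 : s (n + 1) ≤ s n := hanti n.le_succ
    have h4 := hsn (n + 1)
    obtain ⟨i1, i2, i3, i4⟩ := ih
    rcases shelfState_succ_cases H s n with ⟨h, e1, e2, e3⟩ | ⟨h, e1, e2, e3⟩ <;>
      rw [e1, e2, e3] <;> refine ⟨?_, ?_, ?_, ?_⟩ <;> linarith

lemma shelfState_width (hs : ∀ i, 0 < s i) (hanti : Antitone s) (hH : s 0 ≤ H / 2) (n : ℕ) :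
    H / 2 * ((shelfState H s n).1 + (shelfState H s n).2.1 - s 0) + (shelfState H s n).2.2 * s n
      ≤ ∑ i ∈ Finset.range (n + 1), s i ^ 2 := by
  induction n with
  | zero =>
    simp [shelfState, sq]
  | succ n ih =>
    have h1 := hs n
    have h2 := hs (n + 1)
    have h3 : s (n + 1) ≤ s n := hanti n.le_succ
    have h4 : s (n + 1) ≤ H / 2 := (hanti (Nat.zero_le _)).trans hH
    obtain ⟨-, -, i3, -⟩ := shelfState_bounds hs hanti hH n
    rw [Finset.sum_range_succ]
    rcases shelfState_succ_cases H s n with ⟨h, e1, e2, e3⟩ | ⟨h, e1, e2, e3⟩ <;> rw [e1, e2, e3]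
    · have := mul_le_mul_of_nonneg_left h3 (h1.le.trans i3)
      nlinarith
    · have : H / 2 * s (n + 1) ≤ (shelfState H s n).2.2 * s n :=
        mul_le_mul (by linarith) h3 h2.le (h1.le.trans i3)
      nlinarith

lemma shelfState_separated (hs : ∀ i, 0 < s i) (hanti : Antitone s) (hH : s 0 ≤ H / 2)
    {i j : ℕ} (hij : i < j) :
    (shelfState H s i).1 + (shelfState H s i).2.1 ≤ (shelfState H s j).1 ∨
      ((shelfState H s j).1 = (shelfState H s i).1 ∧
        (shelfState H s j).2.1 = (shelfState H s i).2.1 ∧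
        (shelfState H s i).2.2 ≤ (shelfState H s j).2.2 - s j) := by
  induction j, hij using Nat.le_induction with
  | base =>
    rcases shelfState_succ_cases H s i with ⟨h, e1, e2, e3⟩ | ⟨h, e1, e2, e3⟩
    · right
      exact ⟨e1, e2, by linarith⟩
    · left
      exact e1.ge
  | succ j hij ih =>
    have h1 := hs j
    obtain ⟨-, j2, -, -⟩ := shelfState_bounds hs hanti hH j
    rcases shelfState_succ_cases H s j with ⟨h, e1, e2, e3⟩ | ⟨h, e1, e2, e3⟩ <;>
      rcases ih with k | ⟨k1, k2, k3⟩
    · left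
      linarith
    · right
      exact ⟨e1.trans k1, e2.trans k2, by linarith⟩
    · left
      linarith
    · left
      linarith

/-- Squares with nonincreasing sides and finite total area pack into a strip of height `H`, in a
width controlled by the largest side and the total area. -/
lemma exists_shelf_packing (hs : ∀ i, 0 < s i) (hanti : Antitone s) (hH : s 0 ≤ H / 2)
    (hsum : Summable fun i => s i ^ 2) :
    ∃ a b : ℕ → ℝ, (∀ i j, i < j → a i + s i ≤ a j ∨ b i + s i ≤ b j) ∧
      ∀ i, 0 ≤ a i ∧ a i + s i ≤ s 0 + 2 / H * ∑' k, s k ^ 2 ∧ 0 ≤ b i ∧ b i + s i ≤ H := by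
  have hHpos : 0 < H := by linarith [hs 0]
  refine ⟨fun i => (shelfState H s i).1, fun i => (shelfState H s i).2.2 - s i, ?_, fun i => ?_⟩
  · intro i j hij
    obtain ⟨-, i2, -, -⟩ := shelfState_bounds hs hanti hH i
    rcases shelfState_separated hs hanti hH hij with k | ⟨-, -, k⟩
    · left
      linarith
    · right
      simpa using k
  · obtain ⟨i1, i2, i3, i4⟩ := shelfState_bounds hs hanti hH i
    refine ⟨i1, ?_, by simpa using i3, by simpa using i4⟩
    have hw := shelfState_width hs hanti hH i
    have ht : ∑ k ∈ Finset.range (i + 1), s k ^ 2 ≤ ∑' k, s k ^ 2 :=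
      hsum.sum_le_tsum _ fun k _ => sq_nonneg _
    have hp : 0 ≤ (shelfState H s i).2.2 * s i := mul_nonneg ((hs i).le.trans i3) (hs i).le
    have key : (shelfState H s i).1 + (shelfState H s i).2.1 - s 0 ≤ 2 / H * ∑' k, s k ^ 2 := by
      rw [div_mul_eq_mul_div, le_div_iff₀ hHpos]
      linarith
    linarith

end shelf

lemma disjoint_Ioo_prod_of_le {x x' y y' z z' t t' : ℝ} (h : x' ≤ y ∨ z' ≤ t) :
    Disjoint (Set.Ioo x x' ×ˢ Set.Ioo z z') (Set.Ioo y y' ×ˢ Set.Ioo t t') := by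
  rw [Set.disjoint_left]
  rintro ⟨u, v⟩ ⟨⟨-, h1⟩, ⟨-, h2⟩⟩ ⟨⟨h3, -⟩, ⟨h4, -⟩⟩
  simp only at h1 h2 h3 h4
  rcases h with h | h <;> linarith

section extents

variable {n : ℕ}

lemma le_pval (w a : Fin n → ℝ) (i j : Fin n) : a i + w i - a j ≤ pval w a :=
  (le_ciSup (f := fun j => a i + w i - a j) (Set.finite_range _).bddAbove j).trans
    (le_ciSup (f := fun i => ⨆ j, (a i + w i - a j)) (Set.finite_range _).bddAbove i)

lemma pval_le (hn : 0 < n) {w a : Fin n → ℝ} {P : ℝ} (h : ∀ i j, a i + w i - a j ≤ P) :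
    pval w a ≤ P := by
  have : Nonempty (Fin n) := ⟨⟨0, hn⟩⟩
  exact ciSup_le fun i => ciSup_le fun j => h i j

lemma self_le_pval (w a : Fin n → ℝ) (i : Fin n) : w i ≤ pval w a := by
  simpa using le_pval w a i i

lemma exists_box (hn : 0 < n) (w a : Fin n → ℝ) :
    ∃ x, ∀ i, x ≤ a i ∧ a i + w i ≤ x + pval w a := by
  have : Nonempty (Fin n) := ⟨⟨0, hn⟩⟩
  obtain ⟨i₀, h₀⟩ := Finite.exists_min a
  exact ⟨a i₀, fun i => ⟨h₀ i, by linarith [le_pval w a i i₀]⟩⟩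

end extents

section main

variable {w l : ℕ → ℝ}

lemma exists_bounded_positioning (hl : ∀ i, 0 < l i)
    (hsum : Summable fun i => l i ^ 2) (hwl : ∀ i, w i ≤ l i) (hanti : Antitone l) :
    ∃ a b : ℕ → ℝ, ∃ P Q : ℝ, IsPositioning w l a b ∧
      (∀ i j, a i + w i - a j ≤ P) ∧ (∀ i j, b i + l i - b j ≤ Q) := by
  obtain ⟨a, b, hsep, hbd⟩ :=
    exists_shelf_packing (H := 2 * l 0) hl hanti (by linarith) hsum
  have key : ∀ i j, i < j → a i + w i ≤ a j ∨ b i + l i ≤ b j := fun i j hij =>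
    (hsep i j hij).imp_left fun h => by linarith [hwl i]
  refine ⟨a, b, l 0 + 2 / (2 * l 0) * ∑' k, l k ^ 2, 2 * l 0, fun i j hij => ?_,
    fun i j => ?_, fun i j => ?_⟩
  · rcases hij.lt_or_gt with h | h
    · exact disjoint_Ioo_prod_of_le (key i j h)
    · exact (disjoint_Ioo_prod_of_le (key j i h)).symm
  · linarith [(hbd i).2.1, (hbd j).1, hwl i]
  · linarith [(hbd i).2.2.2, (hbd j).2.2.1]

lemma T0_le_of_positioning (hw : ∀ i, 0 < w i) (hl : ∀ i, 0 < l i) {a b : ℕ → ℝ} {P Q : ℝ}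
    (hpos : IsPositioning w l a b) (hP : ∀ i j, a i + w i - a j ≤ P)
    (hQ : ∀ i j, b i + l i - b j ≤ Q) {n : ℕ} (hn : 0 < n) :
    T0 (fun i : Fin n => w i) (fun i : Fin n => l i) ≤ P * Q := by
  have hp := fun a : Fin n → ℝ => (hw 0).le.trans (self_le_pval (fun i : Fin n => w i) a ⟨0, hn⟩)
  have hq := fun b : Fin n → ℝ => (hl 0).le.trans (self_le_pval (fun i : Fin n => l i) b ⟨0, hn⟩)
  have h1 : T0 (fun i : Fin n => w i) (fun i : Fin n => l i) ≤
      Tval (fun i : Fin n => w i) (fun i => l i) (fun i => a i) (fun i => b i) := by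
    refine csInf_le ⟨0, ?_⟩ ⟨_, _, fun i j hij => hpos i j (Fin.val_ne_of_ne hij), rfl⟩
    rintro t ⟨a, b, -, rfl⟩
    exact mul_nonneg (hp a) (hq b)
  refine h1.trans (mul_le_mul (pval_le hn fun i j => hP i j) (pval_le hn fun i j => hQ i j)
    (hq _) ?_)
  have := hP 0 0
  linarith [hw 0]

lemma T0inf_le (hw : ∀ i, 0 < w i) (hl : ∀ i, 0 < l i) {a b : ℕ → ℝ} {P Q : ℝ}
    (hpos : IsPositioning w l a b) (hP : ∀ i j, a i + w i - a j ≤ P)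
    (hQ : ∀ i j, b i + l i - b j ≤ Q) : T0inf w l ≤ P * Q := by
  refine csInf_le ⟨0, ?_⟩ ⟨a, b, P, Q, hpos, hP, hQ, rfl⟩
  rintro t ⟨a, b, P, Q, -, hP, hQ, rfl⟩
  have h1 := hP 0 0
  have h2 := hQ 0 0
  exact mul_nonneg (by linarith [hw 0]) (by linarith [hl 0])

/-- A positioning of the first `n` rectangles extends to the whole family by packing the remaining
ones in a strip to the right of the bounding box. -/
lemma T0inf_le_Tval_mul (hw : ∀ i, 0 < w i) (hl : ∀ i, 0 < l i)
    (hsum : Summable fun i => l i ^ 2) (hwl : ∀ i, w i ≤ l i) (hanti : Antitone l) {n : ℕ}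
    (hn : 0 < n) (hln : l n ≤ l 0 / 2) {a b : Fin n → ℝ}
    (hpos : IsPositioning (fun i : Fin n => w i) (fun i : Fin n => l i) a b) :
    T0inf w l ≤ Tval (fun i : Fin n => w i) (fun i : Fin n => l i) a b *
      (1 + (l n + 2 / l 0 * ∑' k, l (k + n) ^ 2) / w 0) := by
  obtain ⟨a', b', hsep, hbd⟩ := exists_shelf_packing (H := l 0) (s := fun k => l (k + n))
    (fun i => hl _) (fun i j h => hanti (by omega)) (by simpa using hln)
    ((summable_nat_add_iff (f := fun i => l i ^ 2) n).2 hsum)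
  simp only [zero_add] at hbd
  obtain ⟨x, hx⟩ := exists_box hn (fun i : Fin n => w i) a
  obtain ⟨y, hy⟩ := exists_box hn (fun i : Fin n => l i) b
  have hpw : w 0 ≤ pval (fun i : Fin n => w i) a :=
    self_le_pval (fun i : Fin n => w i) a ⟨0, hn⟩
  have hql : l 0 ≤ pval (fun i : Fin n => l i) b :=
    self_le_pval (fun i : Fin n => l i) b ⟨0, hn⟩
  have hT : Tval (fun i : Fin n => w i) (fun i : Fin n => l i) a b =
    pval (fun i : Fin n => w i) a * pval (fun i : Fin n => l i) b := rfl
  rw [hT]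
  set p := pval (fun i : Fin n => w i) a
  set q := pval (fun i : Fin n => l i) b
  set d := l n + 2 / l 0 * ∑' k, l (k + n) ^ 2
  have hd : 0 ≤ d := by
    have := hbd 0
    linarith [hl (0 + n)]
  have hw0 := hw 0
  have hl0 := hl 0
  let A : ℕ → ℝ := fun i => if h : i < n then a ⟨i, h⟩ else x + p + a' (i - n)
  let B : ℕ → ℝ := fun i => if h : i < n then b ⟨i, h⟩ else y + b' (i - n)
  have hA₁ : ∀ i (h : i < n), A i = a ⟨i, h⟩ := fun i h => dif_pos h
  have hA₂ : ∀ i, ¬ i < n → A i = x + p + a' (i - n) := fun i h => dif_neg h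
  have hB₁ : ∀ i (h : i < n), B i = b ⟨i, h⟩ := fun i h => dif_pos h
  have hB₂ : ∀ i, ¬ i < n → B i = y + b' (i - n) := fun i h => dif_neg h
  have hbd' : ∀ i, ¬ i < n → 0 ≤ a' (i - n) ∧ a' (i - n) + l i ≤ d ∧
      0 ≤ b' (i - n) ∧ b' (i - n) + l i ≤ l 0 := fun i h => by
    have := hbd (i - n)
    rwa [Nat.sub_add_cancel (not_lt.mp h)] at this
  have hAx : ∀ i, x ≤ A i ∧ A i + w i ≤ x + p + d := fun i => by
    by_cases h : i < n
    · rw [hA₁ i h]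
      have := hx ⟨i, h⟩
      exact ⟨this.1, by linarith [this.2]⟩
    · rw [hA₂ i h]
      have := hbd' i h
      exact ⟨by linarith, by linarith [hwl i]⟩
  have hBy : ∀ i, y ≤ B i ∧ B i + l i ≤ y + q := fun i => by
    by_cases h : i < n
    · rw [hB₁ i h]
      exact hy ⟨i, h⟩
    · rw [hB₂ i h]
      have := hbd' i h
      exact ⟨by linarith, by linarith⟩
  have hdisj : ∀ i j, i < j → Disjoint
      (Set.Ioo (A i) (A i + w i) ×ˢ Set.Ioo (B i) (B i + l i))
      (Set.Ioo (A j) (A j + w j) ×ˢ Set.Ioo (B j) (B j + l j)) := by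
    intro i j hij
    by_cases hj : j < n
    · have hi := hij.trans hj
      rw [hA₁ i hi, hA₁ j hj, hB₁ i hi, hB₁ j hj]
      exact hpos ⟨i, hi⟩ ⟨j, hj⟩ (by simpa using hij.ne)
    · apply disjoint_Ioo_prod_of_le
      by_cases hi : i < n
      · left
        rw [hA₁ i hi, hA₂ j hj]
        linarith [(hx ⟨i, hi⟩).2, (hbd' j hj).1]
      · rw [hA₂ i hi, hA₂ j hj, hB₂ i hi, hB₂ j hj]
        have h := hsep (i - n) (j - n) (by omega)
        rw [Nat.sub_add_cancel (not_lt.mp hi)] at h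
        rcases h with h | h
        · left
          linarith [hwl i]
        · right
          linarith
  have hle : T0inf w l ≤ (p + d) * q := by
    refine T0inf_le hw hl (a := A) (b := B) (fun i j hij => ?_) (fun i j => ?_) (fun i j => ?_)
    · rcases hij.lt_or_gt with h | h
      · exact hdisj i j h
      · exact (hdisj j i h).symm
    · linarith [(hAx i).2, (hAx j).1]
    · linarith [(hBy i).2, (hBy j).1]
  have hdp : d ≤ p * (d / w 0) := by
    rw [← mul_div_assoc, le_div_iff₀ hw0, mul_comm p]
    exact mul_le_mul_of_nonneg_left hpw hd
  calc T0inf w l ≤ (p + d) * q := hle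
    _ ≤ (p + p * (d / w 0)) * q :=
        mul_le_mul_of_nonneg_right (by linarith) (hl0.le.trans hql)
    _ = p * q * (1 + d / w 0) := by ring

end main

/-- Convergence of minimal bounding areas, Theorem 2:
`T₀(Aⁿ) → T₀(A)` as `n → ∞`. -/
theorem T0_prefix_tendsto_T0inf (w l : ℕ → ℝ)
    (hw : ∀ i, 0 < w i) (hl : ∀ i, 0 < l i)
    (hC1 : Summable fun i => l i ^ 2)
    (hC2 : ∀ i, w i ≤ l i) (hC2' : ∀ i, l (i + 1) ≤ l i) :
    Filter.Tendsto (fun n : ℕ => T0 (fun i : Fin n => w i) (fun i : Fin n => l i))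
      Filter.atTop (nhds (T0inf w l)) := by
  have hanti : Antitone l := antitone_nat_of_succ_le hC2'
  have hl0 := hl 0
  have hw0 := hw 0
  obtain ⟨a, b, P, Q, hpos, hP, hQ⟩ := exists_bounded_positioning hl hC1 hC2 hanti
  have hlim : Filter.Tendsto l Filter.atTop (nhds 0) := by
    have h := (Real.continuous_sqrt.tendsto 0).comp hC1.tendsto_atTop_zero
    simpa [Function.comp_def, Real.sqrt_sq (hl _).le] using h
  let c : ℕ → ℝ := fun n => 1 + (l n + 2 / l 0 * ∑' k, l (k + n) ^ 2) / w 0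
  have hc : Filter.Tendsto c Filter.atTop (nhds 1) := by
    have h := ((hlim.add ((tendsto_sum_nat_add fun i => l i ^ 2).const_mul
      (2 / l 0))).div_const (w 0)).const_add 1
    simpa using h
  have hdiv : Filter.Tendsto (fun n => T0inf w l / c n) Filter.atTop (nhds (T0inf w l)) := by
    simpa [Pi.div_def] using tendsto_const_nhds.div hc one_ne_zero
  refine tendsto_of_tendsto_of_tendsto_of_le_of_le' hdiv tendsto_const_nhds ?_ ?_
  · filter_upwards [Filter.eventually_gt_atTop 0,
      hlim.eventually_le_const (show (0 : ℝ) < l 0 / 2 by linarith)] with n hn hln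
    have hcn : 0 < c n := by
      have : 0 ≤ ∑' k, l (k + n) ^ 2 := tsum_nonneg fun k => sq_nonneg _
      have := (hl n).le
      positivity
    refine le_csInf ⟨_, _, _, fun i j hij => hpos i j (Fin.val_ne_of_ne hij), rfl⟩ ?_
    rintro t ⟨a, b, hab, rfl⟩
    rw [div_le_iff₀ hcn]
    exact T0inf_le_Tval_mul hw hl hC1 hC2 hanti hn hln hab
  · filter_upwards [Filter.eventually_gt_atTop 0] with n hn
    refine le_csInf ⟨_, a, b, P, Q, hpos, hP, hQ, rfl⟩ ?_
    rintro t ⟨a, b, P, Q, hpos, hP, hQ, rfl⟩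
    exact T0_le_of_positioning hw hl hpos hP hQ hn
end
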